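/- There exists a Steiner triple system of order 43 admitting a strict 3-bicoloring, that is, a partition of its 43 points into 3 nonempty color classes such that every block intersects exactly two of the classes. -/

import Mathlib

/-- `(V, B)` is a Steiner triple system: every block is a 3-element subset of `V`,
and every pair of distinct points of `V` lies in exactly one block. -/
def IsSTS (V : Finset ℕ) (B : Finset (Finset ℕ)) : Prop :=
  (∀ b ∈ B, b.card = 3 ∧ b ⊆ V) ∧
  ∀ x ∈ V, ∀ y ∈ V, x ≠ y → ∃! b, b ∈ B ∧ x ∈ b ∧ y ∈ b

namespace BicoloredSTS

/-- The order-five permutation of the points `0, …, 42` (fixing `40`, `41`, `42`), iterated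
`i` times. -/
def rotate (i x : ℕ) : ℕ := if x < 40 then 5 * (x / 5) + (x + i) % 5 else x

/-- Representatives of the block orbits of length five. -/
def baseTriples : List (ℕ × ℕ × ℕ) :=
  [(0, 1, 27), (0, 2, 25), (0, 5, 24), (0, 6, 10), (0, 7, 34), (0, 8, 33),
   (0, 9, 38), (0, 11, 40), (0, 12, 16), (0, 13, 23), (0, 14, 17), (0, 15, 22),
   (0, 18, 21), (0, 19, 20), (0, 29, 41), (0, 30, 36), (0, 31, 39), (0, 32, 42),
   (0, 35, 37), (5, 6, 21), (5, 7, 10), (5, 11, 22), (5, 12, 17), (5, 15, 40),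
   (5, 16, 19), (5, 18, 23), (5, 25, 34), (5, 26, 33), (5, 27, 42), (5, 28, 31),
   (5, 29, 38), (5, 35, 36), (5, 37, 41), (10, 11, 34), (10, 12, 39), (10, 16, 35),
   (10, 17, 41), (10, 22, 29), (10, 23, 36), (10, 24, 42), (10, 25, 38), (10, 26, 31),
   (10, 27, 28), (10, 30, 32), (15, 16, 26), (15, 24, 32), (15, 27, 33), (15, 28, 38),
   (15, 29, 35), (15, 30, 31), (15, 34, 36), (15, 37, 42), (20, 21, 35), (20, 22, 31),
   (20, 25, 28), (20, 26, 40), (20, 29, 36), (20, 30, 41), (20, 32, 37), (30, 39, 40)]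

/-- All 301 blocks, as ordered triples. -/
def triples : List (ℕ × ℕ × ℕ) :=
  (40, 41, 42) :: (List.range 5).flatMap fun i =>
    baseTriples.map fun t => (rotate i t.1, rotate i t.2.1, rotate i t.2.2)

/-- The color of a point; the color classes have sizes 10, 16 and 17. -/
def color (x : ℕ) : ℕ :=
  if x < 10 then 0 else if x < 25 then 1 else if x < 40 then 2 else if x = 40 then 1 else 2

/-- The color class of color `i`. -/
def colorClass (i : ℕ) : Finset ℕ := (Finset.range 43).filter fun x => color x = i

/-- Boolean membership of a point in a triple. -/
def hasPoint (x : ℕ) (t : ℕ × ℕ × ℕ) : Bool :=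
  Nat.beq x t.1 || Nat.beq x t.2.1 || Nat.beq x t.2.2

/-- The set of points of a triple. -/
def toBlock (t : ℕ × ℕ × ℕ) : Finset ℕ := {t.1, t.2.1, t.2.2}

theorem mem_toBlock {x : ℕ} {t : ℕ × ℕ × ℕ} : x ∈ toBlock t ↔ hasPoint x t = true := by
  simp [toBlock, hasPoint, or_assoc]

theorem triples_lt_and_ne : ∀ t ∈ triples,
    (t.1 < 43 ∧ t.2.1 < 43 ∧ t.2.2 < 43) ∧ t.1 ≠ t.2.1 ∧ t.1 ≠ t.2.2 ∧ t.2.1 ≠ t.2.2 := by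
  decide +kernel

theorem length_filter_triples : ∀ x < 43, ∀ y < 43, x ≠ y →
    ((triples.filter (hasPoint x)).filter (hasPoint y)).length = 1 := by
  decide +kernel

theorem triples_color : ∀ t ∈ triples,
    ((if color t.1 = 0 ∨ color t.2.1 = 0 ∨ color t.2.2 = 0 then 1 else 0) +
      (if color t.1 = 1 ∨ color t.2.1 = 1 ∨ color t.2.2 = 1 then 1 else 0) +
      (if color t.1 = 2 ∨ color t.2.1 = 2 ∨ color t.2.2 = 2 then 1 else 0) : ℕ) = 2 := by
  decide +kernel

theorem toBlock_inter_colorClass_nonempty {t : ℕ × ℕ × ℕ} (ht : t ∈ triples) (i : ℕ) :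
    (toBlock t ∩ colorClass i).Nonempty ↔
      color t.1 = i ∨ color t.2.1 = i ∨ color t.2.2 = i := by
  obtain ⟨⟨h1, h2, h3⟩, -⟩ := triples_lt_and_ne t ht
  simp [Finset.Nonempty, toBlock, colorClass, or_and_right, exists_or, h1, h2, h3]

theorem disjoint_colorClass {i j : ℕ} (hij : i ≠ j) : Disjoint (colorClass i) (colorClass j) :=
  Finset.disjoint_filter.2 fun _ _ hi hj => hij (hi.symm.trans hj)

theorem colorClass_union : colorClass 0 ∪ colorClass 1 ∪ colorClass 2 = Finset.range 43 := by
  ext x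
  simp only [colorClass, color, Finset.mem_union, Finset.mem_range]
  grind

theorem isSTS_triples :
    IsSTS (Finset.range 43) (triples.map toBlock).toFinset := by
  simp only [IsSTS, List.mem_toFinset, List.mem_map]
  refine ⟨?_, fun x hx y hy hxy => ?_⟩
  · rintro _ ⟨t, ht, rfl⟩
    obtain ⟨⟨h1, h2, h3⟩, h12, h13, h23⟩ := triples_lt_and_ne t ht
    refine ⟨Finset.card_eq_three.2 ⟨_, _, _, h12, h13, h23, rfl⟩, ?_⟩
    simp [toBlock, Finset.insert_subset_iff, h1, h2, h3]
  · obtain ⟨t, ht⟩ := List.length_eq_one_iff.1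
      (length_filter_triples x (Finset.mem_range.1 hx) y (Finset.mem_range.1 hy) hxy)
    have key (s : ℕ × ℕ × ℕ) : (s ∈ triples ∧ x ∈ toBlock s) ∧ y ∈ toBlock s ↔ s = t := by
      simp only [mem_toBlock, ← List.mem_filter, ht, List.mem_singleton]
    obtain ⟨⟨htm, htx⟩, hty⟩ := (key t).2 rfl
    refine ⟨toBlock t, ⟨⟨t, htm, rfl⟩, htx, hty⟩, ?_⟩
    rintro _ ⟨⟨s, hs, rfl⟩, hsx, hsy⟩
    rw [(key s).1 ⟨⟨hs, hsx⟩, hsy⟩]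

end BicoloredSTS

open BicoloredSTS in
theorem stmt_12 :
    ∃ (V : Finset ℕ) (B : Finset (Finset ℕ)),
      V.card = 43 ∧ IsSTS V B ∧
      ∃ X1 X2 X3 : Finset ℕ,
        X1.Nonempty ∧
        X2.Nonempty ∧
        X3.Nonempty ∧
        Disjoint X1 X2 ∧
        Disjoint X1 X3 ∧
        Disjoint X2 X3 ∧
        X1 ∪ X2 ∪ X3 = V ∧
        ∀ b ∈ B,
          (((if (b ∩ X1).Nonempty then 1 else 0) +
           (if (b ∩ X2).Nonempty then 1 else 0) +
           (if (b ∩ X3).Nonempty then 1 else 0) : ℕ) = 2) := by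
  refine ⟨Finset.range 43, (triples.map toBlock).toFinset, Finset.card_range 43, isSTS_triples,
    colorClass 0, colorClass 1, colorClass 2, ⟨0, by decide⟩, ⟨10, by decide⟩, ⟨25, by decide⟩,
    disjoint_colorClass (by decide), disjoint_colorClass (by decide),
    disjoint_colorClass (by decide), colorClass_union, fun b hb => ?_⟩
  obtain ⟨t, ht, rfl⟩ := List.mem_map.1 (List.mem_toFinset.1 hb)
  simp only [toBlock_inter_colorClass_nonempty ht]
  exact triples_color t ht
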